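/- Alt_10 S^⧢[ 2·Ĩ^+_{4,1}( (ρ_{1,2}ρ_{3,4})/(ρ_{1,4}ρ_{3,2}), ρ_{4,5}/ρ_{4,1} ) ] = Alt_10 S^⧢[ Ĩ^+_{4,1}( −2·W( ρ_{2,1}/ρ_{2,3}, ρ_{3,4}/ρ_{1,4} ) − W( CR(340|9625), CR(234|1650) ) + W( CR(450|9736), CR(345|2760) ) + (1/3)·W( CR(340|9625), CR(340|9657) ) + (1/3)·W( CR(345|2706), CR(347|2560) ), ρ_{4,5}/ρ_{4,1} ) ] in V_F^{⊗5}, where W(u, w) := [u] + [w] + [(1 − u)/(1 − uw)] + [1 − uw] + [(1 − w)/(1 − uw)] and Ĩ^+_{4,1} is extended ℚ-linearly in its first argument to formal combinations. -/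

import Mathlib

open scoped TensorProduct
open PiTensorProduct

attribute [local instance] Classical.propDecidable

set_option maxHeartbeats 1000000
set_option synthInstance.maxHeartbeats 400000

noncomputable section

namespace GrassPoly

variable (F : Type) [Field F]

/-- `V_F = F^× ⊗_ℤ ℚ` as a `ℚ`-vector space. -/
abbrev VF : Type := ℚ ⊗[ℤ] (Additive Fˣ)

variable {F}

/-- The class `[a]` of a nonzero field element in `V_F` (defined to be `0` for `a = 0`). -/
def cls (a : F) : VF F :=
  if h : a = 0 then 0 else (1 : ℚ) ⊗ₜ[ℤ] (Additive.ofMul (Units.mk0 a h))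

variable (F) in
/-- Tensor powers of V_F over ℚ. -/
abbrev TP (n : ℕ) : Type := ⨂[ℚ]^n (VF F)

instance instTPAddCommGroup (n : ℕ) : AddCommGroup (TP F n) :=
  Module.addCommMonoidToAddCommGroup ℚ

/-- Appending one extra tensor factor on the right. -/
def snoc {n : ℕ} : TP F n →ₗ[ℚ] VF F →ₗ[ℚ] TP F (n + 1) :=
  PiTensorProduct.lift
    ((PiTensorProduct.tprod ℚ (s := fun _ : Fin (n + 1) => VF F)).curryRight)

/-- The factor `t_i` appearing in the recursive definition of the symbol,
as a function of `(a_{i-1}, a_i, a_{i+1})`. -/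
def tCoef (p a q : F) : VF F :=
  if p = a then (if a = q then 0 else cls (q - a))
  else if a = q then - cls (p - a)
  else cls ((q - a) / (p - a))

/-- The symbol `S I(a₀; a₁, …, a_m; a_{m+1})`, with the middle entries given as a list
(of length `n`). -/
def SIaux : (n : ℕ) → (a0 : F) → (as : List F) → (b : F) → as.length = n → TP F n
  | 0, _, _, _, _ => tprod ℚ (fun i : Fin 0 => i.elim0)
  | n + 1, a0, as, b, h =>
      ∑ i : Fin (n + 1),
        snoc (SIaux n a0 (as.eraseIdx i.val) b
            (by
              have hi' := i.isLt
              have hi : i.val < as.length := by omega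
              have h2 := List.length_eraseIdx_of_lt hi
              omega))
          (tCoef ((a0 :: as).getD i.val 0) (as.getD i.val 0) ((as ++ [b]).getD (i.val + 1) 0))

/-- Cyclic rotation `b₁ ⊗ … ⊗ b_N ↦ b₂ ⊗ … ⊗ b_N ⊗ b₁` on tensor powers. -/
def rotN (n : ℕ) : TP F n ≃ₗ[ℚ] TP F n :=
  PiTensorProduct.reindex ℚ (fun _ : Fin n => VF F) (finRotate n).symm

/-- Splitting off the last tensor factor. -/
def splitLast (n : ℕ) : TP F (n + 1) ≃ₗ[ℚ] (TP F n) ⊗[ℚ] (VF F) :=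
  ((PiTensorProduct.reindex ℚ (fun _ : Fin (n + 1) => VF F)
      (finSumFinEquiv (m := n) (n := 1)).symm).trans
    (PiTensorProduct.tmulEquiv ℚ (VF F)).symm).trans
    (TensorProduct.congr (LinearEquiv.refl ℚ _)
      (PiTensorProduct.subsingletonEquiv (0 : Fin 1)))

/-- The projector `Π̃_N` annihilating symbols of products. -/
def Pit : (n : ℕ) → TP F n →ₗ[ℚ] TP F n
  | 0 => LinearMap.id
  | 1 => LinearMap.id
  | (n + 2) =>
      ((splitLast (n + 1)).symm.toLinearMap
        ∘ₗ TensorProduct.map (Pit (n + 1)) LinearMap.id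
        ∘ₗ (splitLast (n + 1)).toLinearMap)
      ∘ₗ ((LinearMap.id : TP F (n + 2) →ₗ[ℚ] TP F (n + 2)) - (rotN (F := F) (n + 2)).toLinearMap)

/-- The map on `V_F` induced by a field automorphism. -/
def vmap (φ : F ≃+* F) : VF F →ₗ[ℚ] VF F :=
  TensorProduct.AlgebraTensorModule.map (LinearMap.id : ℚ →ₗ[ℚ] ℚ)
    (AddMonoidHom.toIntLinearMap
      { toFun := fun a => Additive.ofMul ((Units.map (φ : F →* F)) a.toMul)
        map_zero' := by simp
        map_add' := by intro a b; simp [_root_.map_mul] })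

/-- The induced map on tensor powers. -/
def tpMap {n : ℕ} (φ : F ≃+* F) : TP F n →ₗ[ℚ] TP F n :=
  PiTensorProduct.map (fun _ => vmap φ)


/-! ### Symbols of (multiple) polylogarithms -/

/-- Symbol of `Li₂`. -/
def SLi2 (x : F) : TP F 2 := - SIaux 2 0 [x⁻¹, 0] 1 rfl

/-- Symbol of `Li₃`. -/
def SLi3 (x : F) : TP F 3 := - SIaux 3 0 [x⁻¹, 0, 0] 1 rfl

/-- Symbol of `Li₄`. -/
def SLi4 (x : F) : TP F 4 := - SIaux 4 0 [x⁻¹, 0, 0, 0] 1 rfl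

/-- Symbol of `Li₅`. -/
def SLi5 (x : F) : TP F 5 := - SIaux 5 0 [x⁻¹, 0, 0, 0, 0] 1 rfl

/-- Symbol of `I_{3,1}(x,y) = I(0; x,0,0,y; 1)`. -/
def SI31 (x y : F) : TP F 4 := SIaux 4 0 [x, 0, 0, y] 1 rfl

/-- Symbol of `I_{4,1}(x,y) = I(0; x,0,0,0,y; 1)`. -/
def SI41 (x y : F) : TP F 5 := SIaux 5 0 [x, 0, 0, 0, y] 1 rfl

/-- Symbol of `I⁺_{4,1}(x,y) = ½ (I_{4,1}(x,y) + I_{4,1}(x,y⁻¹))`. -/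
def I41p (x y : F) : TP F 5 := (2 : ℚ)⁻¹ • (SI41 x y + SI41 x y⁻¹)

/-- The anharmonic orbit of `x`, together with the signs of the
corresponding permutations in `S₃`. -/
def anhList (x : F) : List (ℚ × F) :=
  [(1, x), (1, (1 - x)⁻¹), (1, 1 - x⁻¹), (-1, x⁻¹), (-1, 1 - x), (-1, x / (x - 1))]

/-- Symbol of `Ĩ_{3,1}(x,y) = (1/36) Σ_{σ,π ∈ S₃} sgn(σ) sgn(π) I_{3,1}(x^σ, y^π)`. -/
def tI31 (x y : F) : TP F 4 :=
  (36 : ℚ)⁻¹ •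
    ((anhList x).map (fun p =>
      ((anhList y).map (fun q => (p.1 * q.1) • SI31 p.2 q.2)).sum)).sum

/-- Symbol of `Ĩ⁺_{4,1}(x,y) = (1/6) Σ_{σ ∈ S₃} sgn(σ) I⁺_{4,1}(x^σ, y)`. -/
def tI41p (x y : F) : TP F 5 :=
  (6 : ℚ)⁻¹ • ((anhList x).map (fun p => p.1 • I41p p.2 y)).sum

/-- Symbol of `V(z; x, y) = Ĩ_{3,1}(z, [x]+[y]+[(1-x)/(1-xy)]+[1-xy]+[(1-y)/(1-xy)])`. -/
def Vc (z x y : F) : TP F 4 :=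
  tI31 z x + tI31 z y + tI31 z ((1 - x) / (1 - x * y)) + tI31 z (1 - x * y)
    + tI31 z ((1 - y) / (1 - x * y))

/-- `Sym₃₆(a,b) := I_{3,1}(a,b) - Ĩ_{3,1}(a,b)` (on the level of symbols). -/
def S36 (a b : F) : TP F 4 := SI31 a b - tI31 a b

/-! ### Generic vectors -/

variable (N m : ℕ)

/-- Polynomial ring on the entries of `N` generic vectors in `m`-space. -/
abbrev Pol : Type := MvPolynomial (Fin N × Fin m) ℚ

/-- The field of rational functions in the entries of `N` generic vectors in `m`-space. -/
abbrev FF : Type := FractionRing (Pol N m)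

/-- The `j`-th coordinate of the `i`-th generic vector. -/
def gen (i : Fin N) (j : Fin m) : FF N m :=
  algebraMap (Pol N m) (FF N m) (MvPolynomial.X (i, j))

/-- `⟨i₁ … i_m⟩`: the determinant of the matrix whose columns are
the generic vectors selected by `cols`. -/
def dets (cols : Fin m → Fin N) : FF N m :=
  (Matrix.of fun r c => gen N m (cols c) r).det

/-- The field automorphism of `FF N m` induced by a permutation of the `N` vectors. -/
def permAut (σ : Equiv.Perm (Fin N)) : FF N m ≃+* FF N m :=
  IsFractionRing.ringEquivOfRingEquiv
    ((MvPolynomial.renameEquiv ℚ (σ.prodCongr (Equiv.refl (Fin m)))).toRingEquiv)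

variable {N m}

/-- Skew-symmetrization over all permutations of the `N` generic vectors. -/
def Alt {n : ℕ} (x : TP (FF N m) n) : TP (FF N m) n :=
  ∑ σ : Equiv.Perm (Fin N), (((Equiv.Perm.sign σ : ℤˣ) : ℤ) : ℚ) • tpMap (permAut N m σ) x

end GrassPoly

end

namespace GrassPoly

noncomputable section W5

/-- The field of rational functions in the entries of 10 generic vectors in 5-space. -/
abbrev K5 : Type := FF 10 5

/-- The vector label `k ∈ {1, …, 9, 0}` as an index (`0` stands for the 10th vector). -/
def L10 (k : ℕ) : Fin 10 := ⟨(k + 9) % 10, Nat.mod_lt _ (by norm_num)⟩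

/-- `⟨abcde⟩` for vector labels in `{1, …, 9, 0}`. -/
def d5 (a b c d e : ℕ) : K5 := dets 10 5 ![L10 a, L10 b, L10 c, L10 d, L10 e]

/-- Vector labels taken mod 8 in `{1, …, 8}`. -/
def M8 (j : ℕ) : ℕ := (j - 1) % 8 + 1

/-- `ρ_i = ρ_{i,i+1,i+2,i+3} = ⟨i,i+1,i+2,i+3,9⟩ / ⟨i,i+1,i+2,i+3,0⟩`, indices mod 8. -/
def rho5 (i : ℕ) : K5 :=
  d5 (M8 i) (M8 (i + 1)) (M8 (i + 2)) (M8 (i + 3)) 9 /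
    d5 (M8 i) (M8 (i + 1)) (M8 (i + 2)) (M8 (i + 3)) 0

/-- `ρ_{i,j} = ρ_i - ρ_j`. -/
def rr5 (i j : ℕ) : K5 := rho5 i - rho5 j

/-- The projected cross-ratio `CR(abc|defg) = ⟨abcdf⟩⟨abceg⟩ / (⟨abcdg⟩⟨abcef⟩)`. -/
def CR5 (a b c d e f g : ℕ) : K5 :=
  (d5 a b c d f * d5 a b c e g) / (d5 a b c d g * d5 a b c e f)

/-- The projected triple-ratio
`R₃(ab|cde,fgh) = ⟨abcdf⟩⟨abceh⟩⟨abdeg⟩ / (⟨abcdg⟩⟨abcef⟩⟨abdeh⟩)`. -/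
def R3 (a b c d e f g h : ℕ) : K5 :=
  (d5 a b c d f * d5 a b c e h * d5 a b d e g) /
    (d5 a b c d g * d5 a b c e f * d5 a b d e h)

/-- The symbol `S(Gr₅) = -2·(5!)²·Alt₁₀ [⟨12345⟩ ⊗ ⟨23456⟩ ⊗ ⟨34567⟩ ⊗ ⟨45678⟩ ⊗ ⟨56789⟩]`. -/
def SGr5 : TP K5 5 :=
  ((-2 : ℚ) * ((Nat.factorial 5 : ℚ)) ^ 2) •
    Alt (tprod ℚ ![cls (d5 1 2 3 4 5), cls (d5 2 3 4 5 6), cls (d5 3 4 5 6 7),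
      cls (d5 4 5 6 7 8), cls (d5 5 6 7 8 9)])

end W5

end GrassPoly

open GrassPoly

namespace GrassPoly

/-- `Ĩ⁺_{4,1}(W(u,w), y)`: the linear extension of `Ĩ⁺_{4,1}` in its first argument applied
to the five-term combination `W(u,w) = [u] + [w] + [(1-u)/(1-uw)] + [1-uw] + [(1-w)/(1-uw)]`. -/
noncomputable def IW (u w y : K5) : TP K5 5 :=
  tI41p u y + tI41p w y + tI41p ((1 - u) / (1 - u * w)) y + tI41p (1 - u * w) y
    + tI41p ((1 - w) / (1 - u * w)) y

end GrassPoly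

namespace GrassPoly

section Naturality

variable {F : Type} [Field F] (φ : F ≃+* F)

lemma vmap_cls (a : F) : vmap φ (cls a) = cls (φ a) := by
  unfold cls
  by_cases h : a = 0
  · simp [h]
  · have h' : φ a ≠ 0 := by simpa using h
    simp only [h, h', dif_neg, not_false_eq_true]
    simp only [vmap, TensorProduct.AlgebraTensorModule.map_tmul, LinearMap.id_apply]
    congr 1
    apply Additive.toMul.injective
    ext
    simp

lemma vmap_tCoef (p a q : F) : vmap φ (tCoef p a q) = tCoef (φ p) (φ a) (φ q) := by
  unfold tCoef
  simp only [φ.injective.eq_iff]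
  split_ifs <;> simp [vmap_cls]

lemma tpMap_tprod {n : ℕ} (v : Fin n → VF F) :
    tpMap φ (tprod ℚ v) = tprod ℚ fun i => vmap φ (v i) := by
  simp [tpMap]

lemma snoc_tprod {n : ℕ} (v : Fin n → VF F) (w : VF F) :
    snoc (tprod ℚ v) w = tprod ℚ (Fin.snoc v w : Fin (n + 1) → VF F) := by
  simp only [snoc, PiTensorProduct.lift.tprod]
  rfl

lemma tpMap_snoc {n : ℕ} (t : TP F n) (v : VF F) :
    tpMap φ (snoc t v) = snoc (tpMap φ t) (vmap φ v) := by
  induction t using PiTensorProduct.induction_on with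
  | smul_tprod r f =>
    simp only [map_smul, LinearMap.smul_apply, snoc_tprod, tpMap_tprod]
    congr 2
    funext i
    refine Fin.lastCases ?_ (fun j => ?_) i <;> simp
  | add x y hx hy => simp only [map_add, LinearMap.add_apply, hx, hy]

lemma SIaux_congr {n : ℕ} {a0 a0' b b' : F} {as as' : List F} (h0 : a0 = a0') (hs : as = as')
    (hb : b = b') (h : as.length = n) (h' : as'.length = n) :
    SIaux n a0 as b h = SIaux n a0' as' b' h' := by
  subst h0 hs hb; rfl

lemma tpMap_SIaux (n : ℕ) (a0 : F) (as : List F) (b : F) (h : as.length = n) :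
    tpMap φ (SIaux n a0 as b h) =
      SIaux n (φ a0) (as.map φ) (φ b) (by simpa using h) := by
  induction n generalizing as with
  | zero =>
    simp only [SIaux, tpMap_tprod]
    congr 1
    funext i
    exact i.elim0
  | succ n ih =>
    simp only [SIaux, map_sum]
    refine Finset.sum_congr rfl fun i _ => ?_
    rw [tpMap_snoc, ih, vmap_tCoef]
    congr 1
    · congr 1
      exact SIaux_congr rfl (by rw [List.eraseIdx_map]) rfl _ _
    · have key : ∀ (l : List F) (k : ℕ), φ (l.getD k 0) = (l.map φ).getD k 0 := by
        intro l k
        rw [← map_zero φ, List.getD_map, map_zero φ]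
      rw [key, key, key]
      simp

lemma tpMap_comp_apply {n : ℕ} (ψ : F ≃+* F) (t : TP F n) :
    tpMap φ (tpMap ψ t) = tpMap (ψ.trans φ) t := by
  induction t using PiTensorProduct.induction_on with
  | smul_tprod r f =>
    simp only [map_smul, tpMap_tprod]
    congr 2
    funext i
    induction f i using TensorProduct.induction_on with
    | zero => simp
    | tmul q a => rfl
    | add x y hx hy => simp only [map_add, hx, hy]
  | add x y hx hy => simp only [map_add, hx, hy]

lemma splitLast_tprod (n : ℕ) (v : Fin (n + 1) → VF F) :
    splitLast n (tprod ℚ v) =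
      tprod ℚ (fun i : Fin n => v i.castSucc) ⊗ₜ[ℚ] v (Fin.last n) := by
  simp only [splitLast, LinearEquiv.trans_apply, PiTensorProduct.reindex_tprod,
    PiTensorProduct.tmulEquiv_symm_apply, TensorProduct.congr_tmul, LinearEquiv.refl_apply,
    PiTensorProduct.subsingletonEquiv_apply_tprod]
  rfl

lemma splitLast_tpMap (n : ℕ) (t : TP F (n + 1)) :
    splitLast n (tpMap φ t) =
      TensorProduct.map (tpMap φ) (vmap φ) (splitLast n t) := by
  induction t using PiTensorProduct.induction_on with
  | smul_tprod r f =>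
    simp only [map_smul, tpMap_tprod, splitLast_tprod, TensorProduct.map_tmul]
  | add x y hx hy => simp only [map_add, hx, hy]

lemma rotN_tpMap (n : ℕ) (t : TP F n) : rotN n (tpMap φ t) = tpMap φ (rotN n t) := by
  induction t using PiTensorProduct.induction_on with
  | smul_tprod r f =>
    simp only [map_smul, tpMap_tprod, rotN, PiTensorProduct.reindex_tprod]
  | add x y hx hy => simp only [map_add, hx, hy]

lemma tpMap_Pit (n : ℕ) (t : TP F n) : tpMap φ (Pit n t) = Pit n (tpMap φ t) := by
  match n with
  | 0 => rfl
  | 1 => rfl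
  | n + 2 =>
    apply (splitLast (n + 1)).injective
    rw [splitLast_tpMap]
    simp only [Pit, LinearMap.comp_apply, LinearEquiv.coe_coe, LinearEquiv.apply_symm_apply,
      LinearMap.sub_apply, LinearMap.id_apply]
    rw [rotN_tpMap, ← map_sub (tpMap φ), splitLast_tpMap]
    generalize splitLast (n + 1) (t - rotN (n + 2) t) = s
    induction s using TensorProduct.induction_on with
    | zero => simp
    | tmul a b => simp only [TensorProduct.map_tmul, LinearMap.id_apply, tpMap_Pit (n + 1) a]
    | add x y hx hy => simp only [map_add, hx, hy]

lemma tpMap_SI41 (x y : F) : tpMap φ (SI41 x y) = SI41 (φ x) (φ y) := by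
  unfold SI41
  rw [tpMap_SIaux]
  exact SIaux_congr (by simp) (by simp) (by simp) _ _

lemma tpMap_tI41p (x y : F) : tpMap φ (tI41p x y) = tI41p (φ x) (φ y) := by
  simp [tI41p, I41p, anhList, tpMap_SI41]

end Naturality

section Anharmonic

variable {F : Type} [Field F]

lemma tI41p_inv {x : F} (hx : x ≠ 0) (y : F) : tI41p x⁻¹ y = -tI41p x y := by
  have h1 : (1 - x⁻¹)⁻¹ = x / (x - 1) := by
    rw [div_eq_mul_inv, ← inv_inv x, ← mul_inv, inv_inv]
    congr 1
    field_simp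
  have h2 : x⁻¹ / (x⁻¹ - 1) = (1 - x)⁻¹ := by
    rw [div_eq_mul_inv, ← mul_inv]
    congr 1
    field_simp
  simp only [tI41p, anhList, List.map_cons, List.map_nil, List.sum_cons, List.sum_nil, inv_inv,
    h1, h2]
  module

lemma tI41p_one_sub {x : F} (hx : x ≠ 0) (hx1 : 1 - x ≠ 0) (y : F) :
    tI41p (1 - x) y = -tI41p x y := by
  have hx2 : x - 1 ≠ 0 := by rw [← neg_sub]; exact neg_ne_zero.2 hx1
  have h1 : 1 - (1 - x)⁻¹ = x / (x - 1) := by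
    field_simp
    ring
  have h2 : (1 - x) / (1 - x - 1) = 1 - x⁻¹ := by
    have : 1 - x - 1 = -x := by ring
    rw [this]
    field_simp
    ring
  simp only [tI41p, anhList, List.map_cons, List.map_nil, List.sum_cons, List.sum_nil,
    sub_sub_cancel, h1, h2]
  module

end Anharmonic

section Alternation

variable {N m : ℕ}

lemma permAut_gen (σ : Equiv.Perm (Fin N)) (i : Fin N) (j : Fin m) :
    permAut N m σ (gen N m i j) = gen N m (σ i) j := by
  simp [permAut, gen]

lemma permAut_trans (σ τ : Equiv.Perm (Fin N)) :
    (permAut N m τ).trans (permAut N m σ) = permAut N m (σ * τ) := by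
  apply RingEquiv.toRingHom_injective
  apply IsFractionRing.injective_comp_algebraMap (A := Pol N m)
  apply MvPolynomial.ringHom_ext
  · intro r
    simp [permAut]
  · rintro ⟨i, j⟩
    simp [permAut]

lemma Alt_tpMap {n : ℕ} (τ : Equiv.Perm (Fin N)) (x : TP (FF N m) n) :
    Alt (tpMap (permAut N m τ) x) = (((Equiv.Perm.sign τ : ℤˣ) : ℤ) : ℚ) • Alt x := by
  unfold Alt
  rw [Finset.smul_sum, ← Equiv.sum_comp (Equiv.mulRight τ)
    fun σ => (((Equiv.Perm.sign τ : ℤˣ) : ℤ) : ℚ) • (((Equiv.Perm.sign σ : ℤˣ) : ℤ) : ℚ) •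
      tpMap (permAut N m σ) x]
  refine Finset.sum_congr rfl fun σ _ => ?_
  rw [tpMap_comp_apply, permAut_trans, smul_smul, Equiv.coe_mulRight, Equiv.Perm.sign_mul]
  congr 1
  rcases Int.units_eq_one_or (Equiv.Perm.sign τ) with h | h <;> simp [h]

lemma permAut_dets (σ : Equiv.Perm (Fin N)) (c : Fin m → Fin N) :
    permAut N m σ (dets N m c) = dets N m (σ ∘ c) := by
  unfold dets
  rw [← RingEquiv.coe_toRingHom, RingHom.map_det]
  congr 1
  ext r k
  simp [permAut_gen]

lemma dets_ne_zero {c : Fin m → Fin N} (hc : Function.Injective c) : dets N m c ≠ 0 := by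
  have h : dets N m c = algebraMap (Pol N m) (FF N m)
      (Matrix.of fun r k => (MvPolynomial.X (c k, r) : Pol N m)).det := by
    rw [RingHom.map_det]
    rfl
  rw [h, Ne, FaithfulSMul.algebraMap_eq_zero_iff]
  intro h0
  have h1 := congrArg (MvPolynomial.eval fun p : Fin N × Fin m => if p.1 = c p.2 then (1 : ℚ) else 0) h0
  rw [RingHom.map_det, map_zero] at h1
  have h2 : (MvPolynomial.eval fun p : Fin N × Fin m =>
      if p.1 = c p.2 then (1 : ℚ) else 0).mapMatrix
      (Matrix.of fun r k => (MvPolynomial.X (c k, r) : Pol N m)) = 1 := by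
    ext r k
    simp [Matrix.one_apply, hc.eq_iff, eq_comm]
  rw [h2, Matrix.det_one] at h1
  exact one_ne_zero h1

end Alternation

end GrassPoly

namespace GrassPoly

section Brackets

lemma dets_permute {N m : ℕ} (c : Fin m → Fin N) (σ : Equiv.Perm (Fin m)) :
    dets N m (c ∘ σ) = ((Equiv.Perm.sign σ : ℤˣ) : ℤ) * dets N m c := by
  simpa [dets, Matrix.submatrix] using
    Matrix.det_permute' σ (Matrix.of fun r k => gen N m (c k) r)

lemma dets_swap {N m : ℕ} (c c' : Fin m → Fin N) {i j : Fin m} (hij : i ≠ j)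
    (h : c = c' ∘ Equiv.swap i j) : dets N m c = -dets N m c' := by
  rw [h, dets_permute, Equiv.Perm.sign_swap hij]
  simp

variable (a b c d e f g : ℕ)

lemma d5_swap_one : d5 a b c d e = -d5 b a c d e :=
  dets_swap _ _ (i := 0) (j := 1) (by simp) (by
    funext k; fin_cases k <;> simp [Equiv.swap_apply_def])

lemma d5_swap_two : d5 a b c d e = -d5 a c b d e :=
  dets_swap _ _ (i := 1) (j := 2) (by simp) (by
    funext k; fin_cases k <;> simp [Equiv.swap_apply_def])

lemma d5_swap_three : d5 a b c d e = -d5 a b d c e :=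
  dets_swap _ _ (i := 2) (j := 3) (by simp) (by
    funext k; fin_cases k <;> simp [Equiv.swap_apply_def])

lemma d5_swap_four : d5 a b c d e = -d5 a b c e d :=
  dets_swap _ _ (i := 3) (j := 4) (by simp) (by
    funext k; fin_cases k <;> simp [Equiv.swap_apply_def])

variable {a b c d e}

lemma d5_sort_one (_ : b < a) : d5 a b c d e = -d5 b a c d e := d5_swap_one a b c d e
lemma d5_sort_two (_ : c < b) : d5 a b c d e = -d5 a c b d e := d5_swap_two a b c d e
lemma d5_sort_three (_ : d < c) : d5 a b c d e = -d5 a b d c e := d5_swap_three a b c d e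
lemma d5_sort_four (_ : e < d) : d5 a b c d e = -d5 a b c e d := d5_swap_four a b c d e

variable (a b c d e)

open Matrix in
lemma d5_plucker :
    d5 a b c d e * d5 a b c f g - d5 a b c d f * d5 a b c e g + d5 a b c d g * d5 a b c e f = 0 := by
  let v : ℕ → Fin 5 → K5 := fun k => gen 10 5 (L10 k)
  let M : ℕ → ℕ → ℕ → ℕ → ℕ → Matrix (Fin 5) (Fin 5) K5 := fun a b c d e =>
    Matrix.of fun r k => gen 10 5 (![L10 a, L10 b, L10 c, L10 d, L10 e] k) r
  have hM : ∀ a b c d e, (M a b c d e).det = d5 a b c d e := fun _ _ _ _ _ => rfl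
  have h3 : ∀ d e k, (M a b c d e).cramer (v k) 3 = d5 a b c k e := by
    intro d e k
    rw [Matrix.cramer_apply, ← hM]
    congr 1
    ext r s
    fin_cases s <;> simp [M, v]
  have h4 : ∀ d e k, (M a b c d e).cramer (v k) 4 = d5 a b c d k := by
    intro d e k
    rw [Matrix.cramer_apply, ← hM]
    congr 1
    ext r s
    fin_cases s <;> simp [M, v]
  have hzero : ∀ i : Fin 5, i ≠ 3 → ∀ k, k = ![a, b, c, d, e] i → i ≠ 4 → d5 a b c k g = 0 := by
    intro i hi k hk hi4
    rw [← hM]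
    refine Matrix.det_zero_of_column_eq (i := i) (j := 3) hi fun r => ?_
    subst hk
    fin_cases i <;> first | rfl | exact absurd rfl hi | exact absurd rfl hi4
  have key : ((M a b c d g).cramer (M a b c d e *ᵥ (M a b c d e).cramer (v f))) 3 =
      d5 a b c d e * d5 a b c f g := by
    rw [Matrix.mulVec_cramer, map_smul, Pi.smul_apply, h3, smul_eq_mul, hM]
  have hexp : M a b c d e *ᵥ (M a b c d e).cramer (v f) =
      ∑ i : Fin 5, (M a b c d e).cramer (v f) i • v (![a, b, c, d, e] i) := by
    ext r
    simp [Matrix.mulVec, dotProduct, Fin.sum_univ_five, M, v]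
    ring
  rw [hexp, Fin.sum_univ_five] at key
  simp only [map_add, map_smul, Pi.add_apply, Pi.smul_apply, h3, h4, smul_eq_mul] at key
  rw [hzero 0 (by decide) _ rfl (by decide), hzero 1 (by decide) _ rfl (by decide),
    hzero 2 (by decide) _ rfl (by decide)] at key
  simp only [Matrix.cons_val, mul_zero, zero_add] at key
  rw [← key, d5_swap_four a b c f e]
  ring

lemma d5_ne_zero (h : [a % 10, b % 10, c % 10, d % 10, e % 10].Nodup) : d5 a b c d e ≠ 0 := by
  apply dets_ne_zero
  have hL : ∀ i j : ℕ, L10 i = L10 j → i % 10 = j % 10 := by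
    intro i j hij
    have := congrArg Fin.val hij
    simp only [L10] at this
    omega
  intro i j hij
  simp only [List.nodup_cons, List.mem_cons, List.not_mem_nil, not_or] at h
  obtain ⟨⟨h1, h2, h3, h4, -⟩, ⟨h5, h6, h7, -⟩, ⟨h8, h9, -⟩, ⟨h10, -⟩, -⟩ := h
  fin_cases i <;> fin_cases j <;> first
    | rfl
    | (exfalso; have := hL _ _ hij; omega)

lemma L10_swap {i j k : ℕ} (hi : i < 10) (hj : j < 10) (hk : k < 10) :
    Equiv.swap (L10 i) (L10 j) (L10 k) = L10 (Equiv.swap i j k) := by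
  have hL : ∀ i j : ℕ, i < 10 → j < 10 → (L10 i = L10 j ↔ i = j) := by
    intro i j hi hj
    rw [Fin.ext_iff]
    simp only [L10]
    omega
  simp only [Equiv.swap_apply_def, hL _ _ hk hi, hL _ _ hk hj]
  split_ifs <;> rfl

variable {a b c d e}

lemma permAut_d5 {i j : ℕ} (hi : i < 10) (hj : j < 10) (ha : a < 10) (hb : b < 10) (hc : c < 10)
    (hd : d < 10) (he : e < 10) :
    permAut 10 5 (Equiv.swap (L10 i) (L10 j)) (d5 a b c d e) =
      d5 (Equiv.swap i j a) (Equiv.swap i j b) (Equiv.swap i j c) (Equiv.swap i j d)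
        (Equiv.swap i j e) := by
  rw [d5, permAut_dets, d5]
  congr 1
  funext k
  fin_cases k <;> simp [L10_swap, *]

end Brackets

end GrassPoly

namespace GrassPoly

noncomputable section

section Evaluation

/-- A linear functional on weight-five tensors which is skew-invariant under permutations of the
ten generic vectors. -/
def IsSkew {M : Type*} [AddCommGroup M] [Module ℚ M] (L : TP K5 5 →ₗ[ℚ] M) : Prop :=
  ∀ (τ : Equiv.Perm (Fin 10)) (t : TP K5 5),
    L (tpMap (permAut 10 5 τ) t) = (((Equiv.Perm.sign τ : ℤˣ) : ℤ) : ℚ) • L t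

/-- The value of the functional `L` on `Ĩ⁺_{4,1}(x, y)`. -/
def evalI {M : Type*} [AddCommGroup M] [Module ℚ M] (L : TP K5 5 →ₗ[ℚ] M) (y x : K5) : M :=
  L (tI41p x y)

variable {M : Type*} [AddCommGroup M] [Module ℚ M] (L : TP K5 5 →ₗ[ℚ] M) {y x : K5}

lemma evalI_inv (hx : x ≠ 0) : evalI L y x⁻¹ = -evalI L y x := by
  rw [evalI, tI41p_inv hx, map_neg, evalI]

lemma evalI_one_sub (hx : x ≠ 0) (hx1 : 1 - x ≠ 0) : evalI L y (1 - x) = -evalI L y x := by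
  rw [evalI, tI41p_one_sub hx hx1, map_neg, evalI]

variable {L}

lemma evalI_swap (hL : IsSkew L) {i j : ℕ} (hi : i < 10) (hj : j < 10) (hij : i ≠ j)
    (hy : permAut 10 5 (Equiv.swap (L10 i) (L10 j)) y = y) :
    evalI L y (permAut 10 5 (Equiv.swap (L10 i) (L10 j)) x) = -evalI L y x := by
  have h : L10 i ≠ L10 j := by
    intro h
    have := congrArg Fin.val h
    simp only [L10] at this
    omega
  unfold evalI
  nth_rewrite 1 [← hy]
  rw [← tpMap_tI41p, hL, Equiv.Perm.sign_swap h]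
  simp

lemma evalI_eq_zero (hL : IsSkew L) {i j : ℕ} (hi : i < 10) (hj : j < 10) (hij : i ≠ j)
    (hy : permAut 10 5 (Equiv.swap (L10 i) (L10 j)) y = y)
    (hx : permAut 10 5 (Equiv.swap (L10 i) (L10 j)) x = x) : evalI L y x = 0 := by
  have h := evalI_swap hL hi hj hij hy (x := x)
  rw [hx] at h
  have h2 : (2 : ℚ) • evalI L y x = 0 := by
    rw [two_smul]
    nth_rewrite 1 [h]
    exact neg_add_cancel _
  exact (smul_eq_zero.1 h2).resolve_left (by norm_num)

end Evaluation

section CrossRatio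

variable {M : Type*} [AddCommGroup M] [Module ℚ M] {L : TP K5 5 →ₗ[ℚ] M} {y : K5}
variable {a b c d e f g : ℕ}

lemma CR5_inv : (CR5 a b c d e f g)⁻¹ = CR5 a b c d e g f := by
  simp only [CR5, inv_div]

lemma CR5_ne_zero (h : [a % 10, b % 10, c % 10, d % 10, e % 10, f % 10, g % 10].Nodup) :
    CR5 a b c d e f g ≠ 0 := by
  unfold CR5
  simp only [List.nodup_cons, List.mem_cons, List.not_mem_nil, not_or] at h
  refine div_ne_zero (mul_ne_zero ?_ ?_) (mul_ne_zero ?_ ?_) <;> apply d5_ne_zero <;>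
    simp only [List.nodup_cons, List.mem_cons, List.not_mem_nil, not_or] <;> tauto

lemma one_sub_CR5 (h : [a % 10, b % 10, c % 10, d % 10, e % 10, f % 10, g % 10].Nodup) :
    1 - CR5 a b c d e f g = CR5 a b c d f e g := by
  have h1 : d5 a b c d g ≠ 0 := by
    apply d5_ne_zero
    simp only [List.nodup_cons, List.mem_cons, List.not_mem_nil, not_or] at h ⊢
    tauto
  have h2 : d5 a b c e f ≠ 0 := by
    apply d5_ne_zero
    simp only [List.nodup_cons, List.mem_cons, List.not_mem_nil, not_or] at h ⊢
    tauto
  have h3 := d5_plucker a b c d e f g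
  unfold CR5
  rw [d5_swap_four a b c f e]
  field_simp
  linear_combination h3

lemma evalI_CR5_swap_three_four
    (h : [a % 10, b % 10, c % 10, d % 10, e % 10, f % 10, g % 10].Nodup) :
    evalI L y (CR5 a b c d e g f) = -evalI L y (CR5 a b c d e f g) := by
  rw [← CR5_inv, evalI_inv L (CR5_ne_zero h)]

lemma evalI_CR5_swap_two_three
    (h : [a % 10, b % 10, c % 10, d % 10, e % 10, f % 10, g % 10].Nodup) :
    evalI L y (CR5 a b c d f e g) = -evalI L y (CR5 a b c d e f g) := by
  have h' := one_sub_CR5 h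
  have h0 : CR5 a b c d f e g ≠ 0 := by
    apply CR5_ne_zero
    simp only [List.nodup_cons, List.mem_cons, List.not_mem_nil, not_or] at h ⊢
    tauto
  rw [← h', evalI_one_sub L (CR5_ne_zero h) (h' ▸ h0)]

lemma CR5_swap_one_two : CR5 a b c e d f g = CR5 a b c d e g f := by
  unfold CR5
  ring

lemma permAut_CR5 {i j : ℕ} (hi : i < 10) (hj : j < 10) (ha : a < 10) (hb : b < 10) (hc : c < 10)
    (hd : d < 10) (he : e < 10) (hf : f < 10) (hg : g < 10) :
    permAut 10 5 (Equiv.swap (L10 i) (L10 j)) (CR5 a b c d e f g) =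
      CR5 (Equiv.swap i j a) (Equiv.swap i j b) (Equiv.swap i j c) (Equiv.swap i j d)
        (Equiv.swap i j e) (Equiv.swap i j f) (Equiv.swap i j g) := by
  simp only [CR5, map_div₀, map_mul, permAut_d5, *]

end CrossRatio

section Rho

/-- `ρ_{abcd} = ⟨abcd9⟩ / ⟨abcd0⟩`. -/
def rhoBr (a b c d : ℕ) : K5 := d5 a b c d 9 / d5 a b c d 0

lemma rhoBr_sub {a b c x y : ℕ} (hx : d5 a b c x 0 ≠ 0) (hy : d5 a b c y 0 ≠ 0) :
    rhoBr a b c x - rhoBr a b c y =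
      d5 a b c x y * d5 a b c 9 0 / (d5 a b c x 0 * d5 a b c y 0) := by
  have h := d5_plucker a b c x y 9 0
  unfold rhoBr
  field_simp
  linear_combination -h

lemma permAut_rhoBr {a b c d i j : ℕ} (hi : i < 9) (hj : j < 9) (hi0 : 0 < i) (hj0 : 0 < j)
    (ha : a < 10) (hb : b < 10) (hc : c < 10) (hd : d < 10) :
    permAut 10 5 (Equiv.swap (L10 i) (L10 j)) (rhoBr a b c d) =
      rhoBr (Equiv.swap i j a) (Equiv.swap i j b) (Equiv.swap i j c) (Equiv.swap i j d) := by
  have hi' : i < 10 := by omega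
  have hj' : j < 10 := by omega
  have h9 : Equiv.swap i j 9 = 9 := Equiv.swap_apply_of_ne_of_ne (by omega) (by omega)
  have h0 : Equiv.swap i j 0 = 0 := Equiv.swap_apply_of_ne_of_ne (by omega) (by omega)
  simp only [rhoBr, map_div₀]
  rw [permAut_d5 hi' hj' ha hb hc hd (by norm_num), permAut_d5 hi' hj' ha hb hc hd (by norm_num),
    h9, h0]

lemma rhoBr_sort_one {a b c d : ℕ} (_ : b < a) : rhoBr a b c d = rhoBr b a c d := by
  rw [rhoBr, d5_swap_one, d5_swap_one a, neg_div_neg_eq, rhoBr]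

lemma rhoBr_sort_two {a b c d : ℕ} (_ : c < b) : rhoBr a b c d = rhoBr a c b d := by
  rw [rhoBr, d5_swap_two a b c d 9, d5_swap_two a b c d 0, neg_div_neg_eq, rhoBr]

lemma rhoBr_sort_three {a b c d : ℕ} (_ : d < c) : rhoBr a b c d = rhoBr a b d c := by
  rw [rhoBr, d5_swap_three a b c d 9, d5_swap_three a b c d 0, neg_div_neg_eq, rhoBr]

end Rho

end

end GrassPoly

namespace GrassPoly

noncomputable section

section Triples

variable {M : Type*} [AddCommGroup M] [Module ℚ M] (L : TP K5 5 →ₗ[ℚ] M) {y a b c : K5}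

lemma evalI_ratio_swap (hab : a - b ≠ 0) (hac : a - c ≠ 0) (hbc : b - c ≠ 0) :
    evalI L y ((b - a) / (b - c)) = -evalI L y ((a - b) / (a - c)) := by
  have h : 1 - (a - b) / (a - c) = (b - c) / (a - c) := by
    field_simp
    ring
  have hne : 1 - (a - b) / (a - c) ≠ 0 := h ▸ div_ne_zero hbc hac
  have h' : 1 - (1 - (a - b) / (a - c))⁻¹ = (b - a) / (b - c) := by
    rw [h]
    field_simp
    ring
  have hba : b - a ≠ 0 := by rw [← neg_sub]; exact neg_ne_zero.2 hab
  rw [← h', evalI_one_sub L (inv_ne_zero hne) (h' ▸ div_ne_zero hba hbc), evalI_inv L hne,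
    evalI_one_sub L (div_ne_zero hab hac) hne, neg_neg]

lemma map_IW (u w y : K5) :
    L (IW u w y) = evalI L y u + evalI L y w + evalI L y ((1 - u) / (1 - u * w))
      + evalI L y (1 - u * w) + evalI L y ((1 - w) / (1 - u * w)) := by
  simp only [IW, map_add, evalI]

end Triples

section Configuration

lemma rr5_one_two : rr5 1 2 = rhoBr 1 2 3 4 - rhoBr 2 3 4 5 := rfl
lemma rr5_two_one : rr5 2 1 = rhoBr 2 3 4 5 - rhoBr 1 2 3 4 := rfl
lemma rr5_two_three : rr5 2 3 = rhoBr 2 3 4 5 - rhoBr 3 4 5 6 := rfl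
lemma rr5_three_two : rr5 3 2 = rhoBr 3 4 5 6 - rhoBr 2 3 4 5 := rfl
lemma rr5_three_four : rr5 3 4 = rhoBr 3 4 5 6 - rhoBr 4 5 6 7 := rfl
lemma rr5_one_four : rr5 1 4 = rhoBr 1 2 3 4 - rhoBr 4 5 6 7 := rfl

/-- The second argument `ρ_{4,5} / ρ_{4,1}`. -/
def yArg : K5 := rr5 4 5 / rr5 4 1

lemma yArg_eq : yArg =
    (rhoBr 4 5 6 7 - rhoBr 5 6 7 8) / (rhoBr 4 5 6 7 - rhoBr 1 2 3 4) := rfl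

lemma yArg_swap_one_two : permAut 10 5 (Equiv.swap (L10 1) (L10 2)) yArg = yArg := by
  simp [yArg_eq, permAut_rhoBr, Equiv.swap_apply_def, rhoBr_sort_one]

lemma yArg_swap_two_three : permAut 10 5 (Equiv.swap (L10 2) (L10 3)) yArg = yArg := by
  simp [yArg_eq, permAut_rhoBr, Equiv.swap_apply_def, rhoBr_sort_two]

lemma yArg_swap_five_six : permAut 10 5 (Equiv.swap (L10 5) (L10 6)) yArg = yArg := by
  simp [yArg_eq, permAut_rhoBr, Equiv.swap_apply_def, rhoBr_sort_one, rhoBr_sort_two]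

lemma yArg_swap_six_seven : permAut 10 5 (Equiv.swap (L10 6) (L10 7)) yArg = yArg := by
  simp [yArg_eq, permAut_rhoBr, Equiv.swap_apply_def, rhoBr_sort_two, rhoBr_sort_three]

lemma yArg_swap_five_seven : permAut 10 5 (Equiv.swap (L10 5) (L10 7)) yArg = yArg := by
  simp [yArg_eq, permAut_rhoBr, Equiv.swap_apply_def, rhoBr_sort_one, rhoBr_sort_two,
    rhoBr_sort_three]

lemma rhoBr_sub_ne_zero {a b c x y : ℕ}
    (h : [a % 10, b % 10, c % 10, x % 10, y % 10, 9, 0].Nodup) :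
    rhoBr a b c x - rhoBr a b c y ≠ 0 := by
  simp only [List.nodup_cons, List.mem_cons, List.not_mem_nil, not_or] at h
  have hx : d5 a b c x 0 ≠ 0 := by
    apply d5_ne_zero
    simp only [List.nodup_cons, List.mem_cons, List.not_mem_nil, not_or]
    tauto
  have hy : d5 a b c y 0 ≠ 0 := by
    apply d5_ne_zero
    simp only [List.nodup_cons, List.mem_cons, List.not_mem_nil, not_or]
    tauto
  rw [rhoBr_sub hx hy]
  refine div_ne_zero (mul_ne_zero ?_ ?_) (mul_ne_zero hx hy) <;> apply d5_ne_zero <;>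
    simp only [List.nodup_cons, List.mem_cons, List.not_mem_nil, not_or] <;> tauto

lemma rho12_ne : rhoBr 1 2 3 4 - rhoBr 2 3 4 5 ≠ 0 := by
  have h := rhoBr_sub_ne_zero (a := 2) (b := 3) (c := 4) (x := 1) (y := 5) (by simp)
  simpa only [rhoBr_sort_one, rhoBr_sort_two, rhoBr_sort_three, Nat.reduceLT] using h

lemma rho23_ne : rhoBr 2 3 4 5 - rhoBr 3 4 5 6 ≠ 0 := by
  have h := rhoBr_sub_ne_zero (a := 3) (b := 4) (c := 5) (x := 2) (y := 6) (by simp)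
  simpa only [rhoBr_sort_one, rhoBr_sort_two, rhoBr_sort_three, Nat.reduceLT] using h

lemma rho34_ne : rhoBr 3 4 5 6 - rhoBr 4 5 6 7 ≠ 0 := by
  have h := rhoBr_sub_ne_zero (a := 4) (b := 5) (c := 6) (x := 3) (y := 7) (by simp)
  simpa only [rhoBr_sort_one, rhoBr_sort_two, rhoBr_sort_three, Nat.reduceLT] using h

lemma rho13_ne : rhoBr 1 2 3 4 - rhoBr 3 4 5 6 ≠ 0 := by
  intro h
  have h' := congrArg (permAut 10 5 (Equiv.swap (L10 1) (L10 8))) h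
  simp [permAut_rhoBr, Equiv.swap_apply_def] at h'
  have h2 := rhoBr_sub_ne_zero (a := 2) (b := 3) (c := 4) (x := 8) (y := 1) (by simp)
  simp only [rhoBr_sort_one, rhoBr_sort_two, rhoBr_sort_three, Nat.reduceLT] at h2 h'
  exact h2 (by linear_combination h' - h)

lemma rho14_ne : rhoBr 1 2 3 4 - rhoBr 4 5 6 7 ≠ 0 := by
  intro h
  have h' := congrArg (permAut 10 5 (Equiv.swap (L10 1) (L10 8))) h
  simp [permAut_rhoBr, Equiv.swap_apply_def] at h'
  have h2 := rhoBr_sub_ne_zero (a := 2) (b := 3) (c := 4) (x := 8) (y := 1) (by simp)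
  simp only [rhoBr_sort_one, rhoBr_sort_two, rhoBr_sort_three, Nat.reduceLT] at h2 h'
  exact h2 (by linear_combination h' - h)

lemma rho24_ne : rhoBr 2 3 4 5 - rhoBr 4 5 6 7 ≠ 0 := by
  intro h
  have h' := congrArg (permAut 10 5 (Equiv.swap (L10 2) (L10 8))) h
  simp [permAut_rhoBr, Equiv.swap_apply_def] at h'
  have h2 := rhoBr_sub_ne_zero (a := 3) (b := 4) (c := 5) (x := 8) (y := 2) (by simp)
  simp only [rhoBr_sort_one, rhoBr_sort_two, rhoBr_sort_three, Nat.reduceLT] at h2 h'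
  exact h2 (by linear_combination h' - h)

variable {M : Type*} [AddCommGroup M] [Module ℚ M] {L : TP K5 5 →ₗ[ℚ] M}

lemma map_IW_rho (hL : IsSkew L) :
    L (IW (rr5 2 1 / rr5 2 3) (rr5 3 4 / rr5 1 4) yArg) =
      evalI L yArg (rr5 2 1 / rr5 2 3)
        - evalI L yArg (rr5 1 2 * rr5 3 4 / (rr5 1 4 * rr5 3 2))
        + evalI L yArg ((rhoBr 2 3 4 5 - rhoBr 3 4 5 6) / (rhoBr 2 3 4 5 - rhoBr 4 5 6 7)) := by
  have h12 := rho12_ne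
  have h13 := rho13_ne
  have h14 := rho14_ne
  have h23 := rho23_ne
  have h24 := rho24_ne
  have h34 := rho34_ne
  have h32 : rhoBr 3 4 5 6 - rhoBr 2 3 4 5 ≠ 0 := by rw [← neg_sub]; exact neg_ne_zero.2 h23
  have hw : evalI L yArg (rr5 3 4 / rr5 1 4) = 0 := by
    apply evalI_eq_zero hL (i := 1) (j := 2) (by simp) (by simp) (by simp) yArg_swap_one_two
    simp [rr5_three_four, rr5_one_four, permAut_rhoBr, Equiv.swap_apply_def, rhoBr_sort_one]
  have h14_24 : evalI L yArg
      ((rhoBr 1 2 3 4 - rhoBr 4 5 6 7) / (rhoBr 2 3 4 5 - rhoBr 4 5 6 7)) = 0 := by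
    apply evalI_eq_zero hL (i := 6) (j := 7) (by simp) (by simp) (by simp) yArg_swap_six_seven
    simp [permAut_rhoBr, Equiv.swap_apply_def, rhoBr_sort_three]
  rw [map_IW, hw]
  simp only [rr5_one_two, rr5_two_one, rr5_two_three, rr5_three_two, rr5_three_four,
    rr5_one_four]
  generalize rhoBr 1 2 3 4 = r₁ at *
  generalize rhoBr 2 3 4 5 = r₂ at *
  generalize rhoBr 3 4 5 6 = r₃ at *
  generalize rhoBr 4 5 6 7 = r₄ at *
  have huw : (r₂ - r₁) / (r₂ - r₃) * ((r₃ - r₄) / (r₁ - r₄)) =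
      (r₁ - r₂) * (r₃ - r₄) / ((r₁ - r₄) * (r₃ - r₂)) := by
    field_simp
    ring
  have huw' : 1 - (r₁ - r₂) * (r₃ - r₄) / ((r₁ - r₄) * (r₃ - r₂)) =
      (r₁ - r₃) * (r₂ - r₄) / ((r₁ - r₄) * (r₂ - r₃)) := by
    field_simp
    ring
  have hu : (1 - (r₂ - r₁) / (r₂ - r₃)) /
      ((r₁ - r₃) * (r₂ - r₄) / ((r₁ - r₄) * (r₂ - r₃))) = (r₁ - r₄) / (r₂ - r₄) := by
    field_simp
    ring
  have hw' : (1 - (r₃ - r₄) / (r₁ - r₄)) /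
      ((r₁ - r₃) * (r₂ - r₄) / ((r₁ - r₄) * (r₂ - r₃))) = (r₂ - r₃) / (r₂ - r₄) := by
    field_simp
    ring
  rw [huw, evalI_one_sub L (by positivity) (by rw [huw']; positivity), huw', hu, hw', h14_24]
  abel

/-- The anharmonic action on the ratio of three values, one of which is moved by an odd
permutation. -/
lemma evalI_mixed {u w r₁ r₂ r₃ r y : K5} (s : K5 ≃+* K5)
    (hs : evalI L y (s ((r₂ - r₁) / (r₂ - r₃))) = -evalI L y ((r₂ - r₁) / (r₂ - r₃)))
    (hs1 : s r₁ = r₁) (hs2 : s r₂ = r) (hs3 : s r₃ = r₃)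
    (h12 : r₁ - r₂ ≠ 0) (h13 : r₁ - r₃ ≠ 0) (h23 : r₂ - r₃ ≠ 0)
    (huw : u * w = (r₂ - r₁) / (r₂ - r₃)) (hu : (1 - u) * (r₂ - r₃) = r - r₃) :
    evalI L y ((1 - u) / (1 - u * w)) + evalI L y (1 - u * w) =
      -(2 : ℚ) • evalI L y ((r₂ - r₁) / (r₂ - r₃)) := by
  have h21 : r₂ - r₁ ≠ 0 := by rw [← neg_sub]; exact neg_ne_zero.2 h12
  have h1 : 1 - (r₂ - r₁) / (r₂ - r₃) = (r₁ - r₃) / (r₂ - r₃) := by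
    field_simp
    ring
  have hr3 : r - r₃ ≠ 0 := by
    rw [← hs2, ← hs3, ← map_sub]
    exact (map_ne_zero s).2 h23
  have hr1 : r - r₁ ≠ 0 := by
    rw [← hs2, ← hs1, ← map_sub]
    exact (map_ne_zero s).2 h21
  have h2 : (1 - u) / ((r₁ - r₃) / (r₂ - r₃)) = (1 - (r - r₁) / (r - r₃))⁻¹ := by
    have : 1 - (r - r₁) / (r - r₃) = (r₁ - r₃) / (r - r₃) := by
      field_simp
      ring
    rw [this, inv_div, ← hu]
    field_simp
  have h3 : 1 - (r - r₁) / (r - r₃) ≠ 0 := by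
    have : 1 - (r - r₁) / (r - r₃) = (r₁ - r₃) / (r - r₃) := by
      field_simp
      ring
    rw [this]
    exact div_ne_zero h13 hr3
  rw [map_div₀, map_sub, map_sub, hs1, hs2, hs3] at hs
  rw [huw, evalI_one_sub L (div_ne_zero h21 h23) (by rw [h1]; exact div_ne_zero h13 h23), h1, h2,
    evalI_inv L h3, evalI_one_sub L (div_ne_zero hr1 hr3) h3, hs]
  module

lemma map_IW_mixed_one (hL : IsSkew L) :
    L (IW (CR5 3 4 0 9 6 2 5) (CR5 2 3 4 1 6 5 0) yArg) =
      evalI L yArg (CR5 3 4 0 9 6 2 5) - (2 : ℚ) • evalI L yArg (rr5 2 1 / rr5 2 3) := by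
  have h25 : rhoBr 2 3 4 5 - rhoBr 3 4 5 6 =
      d5 0 3 4 5 9 * d5 2 3 4 5 6 / (d5 0 2 3 4 5 * d5 0 3 4 5 6) := by
    have h := rhoBr_sub (a := 3) (b := 4) (c := 5) (x := 2) (y := 6)
      (d5_ne_zero _ _ _ _ _ (by simp)) (d5_ne_zero _ _ _ _ _ (by simp))
    simp only [rhoBr_sort_one, rhoBr_sort_two, rhoBr_sort_three, d5_sort_one, d5_sort_two,
      d5_sort_three, d5_sort_four, Nat.reduceLT] at h
    rw [h]
    ring
  have h15 : rhoBr 2 3 4 5 - rhoBr 1 2 3 4 =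
      -(d5 0 2 3 4 9 * d5 1 2 3 4 5) / (d5 0 2 3 4 5 * d5 0 1 2 3 4) := by
    have h := rhoBr_sub (a := 2) (b := 3) (c := 4) (x := 5) (y := 1)
      (d5_ne_zero _ _ _ _ _ (by simp)) (d5_ne_zero _ _ _ _ _ (by simp))
    simp only [rhoBr_sort_one, rhoBr_sort_two, rhoBr_sort_three, d5_sort_one, d5_sort_two,
      d5_sort_three, d5_sort_four, Nat.reduceLT] at h
    rw [h]
    ring
  have h26 : rhoBr 2 3 4 6 - rhoBr 3 4 5 6 =
      d5 0 3 4 6 9 * d5 2 3 4 5 6 / (d5 0 2 3 4 6 * d5 0 3 4 5 6) := by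
    have h := rhoBr_sub (a := 3) (b := 4) (c := 6) (x := 2) (y := 5)
      (d5_ne_zero _ _ _ _ _ (by simp)) (d5_ne_zero _ _ _ _ _ (by simp))
    simp only [rhoBr_sort_one, rhoBr_sort_two, rhoBr_sort_three, d5_sort_one, d5_sort_two,
      d5_sort_three, d5_sort_four, Nat.reduceLT] at h
    rw [h]
    ring
  have n1 : d5 0 2 3 4 5 ≠ 0 := d5_ne_zero _ _ _ _ _ (by simp)
  have n2 : d5 0 3 4 5 6 ≠ 0 := d5_ne_zero _ _ _ _ _ (by simp)
  have n3 : d5 0 1 2 3 4 ≠ 0 := d5_ne_zero _ _ _ _ _ (by simp)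
  have n4 : d5 0 2 3 4 6 ≠ 0 := d5_ne_zero _ _ _ _ _ (by simp)
  have n5 : d5 0 3 4 5 9 ≠ 0 := d5_ne_zero _ _ _ _ _ (by simp)
  have n6 : d5 2 3 4 5 6 ≠ 0 := d5_ne_zero _ _ _ _ _ (by simp)
  have h13 := rho13_ne
  have h23 := rho23_ne
  have huw : CR5 3 4 0 9 6 2 5 * CR5 2 3 4 1 6 5 0 =
      (rhoBr 2 3 4 5 - rhoBr 1 2 3 4) / (rhoBr 2 3 4 5 - rhoBr 3 4 5 6) := by
    rw [h25, h15]
    simp only [CR5, d5_sort_one, d5_sort_two, d5_sort_three, d5_sort_four, Nat.reduceLT]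
    field_simp
  have hu : (1 - CR5 3 4 0 9 6 2 5) * (rhoBr 2 3 4 5 - rhoBr 3 4 5 6) =
      rhoBr 2 3 4 6 - rhoBr 3 4 5 6 := by
    rw [one_sub_CR5 (by simp), h25, h26]
    simp only [CR5, d5_sort_one, d5_sort_two, d5_sort_three, d5_sort_four, Nat.reduceLT]
    field_simp
  have hmix := evalI_mixed (L := L) (y := yArg)
    (permAut 10 5 (Equiv.swap (L10 5) (L10 6)))
    (evalI_swap hL (by simp) (by simp) (by simp) yArg_swap_five_six)
    (by simp [permAut_rhoBr, Equiv.swap_apply_def])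
    (r := rhoBr 2 3 4 6) (by simp [permAut_rhoBr, Equiv.swap_apply_def])
    (by simp [permAut_rhoBr, Equiv.swap_apply_def, rhoBr_sort_three])
    rho12_ne h13 h23 huw hu
  have hw0 : evalI L yArg (CR5 2 3 4 1 6 5 0) = 0 := by
    apply evalI_eq_zero hL (i := 2) (j := 3) (by simp) (by simp) (by simp) yArg_swap_two_three
    rw [permAut_CR5 (by simp) (by simp) (by simp) (by simp) (by simp) (by simp) (by simp) (by simp)
      (by simp)]
    simp [Equiv.swap_apply_def, CR5, d5_sort_one]
  have hw : (1 - CR5 2 3 4 1 6 5 0) / (1 - CR5 3 4 0 9 6 2 5 * CR5 2 3 4 1 6 5 0) =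
      d5 1 2 3 4 6 * d5 0 3 4 5 9 / (d5 0 1 2 3 4 * d5 0 3 4 5 6) /
        (rhoBr 1 2 3 4 - rhoBr 3 4 5 6) := by
    have : 1 - (rhoBr 2 3 4 5 - rhoBr 1 2 3 4) / (rhoBr 2 3 4 5 - rhoBr 3 4 5 6) =
        (rhoBr 1 2 3 4 - rhoBr 3 4 5 6) / (rhoBr 2 3 4 5 - rhoBr 3 4 5 6) := by
      field_simp
      ring
    rw [huw, this, div_div_eq_mul_div, one_sub_CR5 (by simp), h25]
    congr 1
    simp only [CR5, d5_sort_one, d5_sort_two, d5_sort_three, d5_sort_four, Nat.reduceLT]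
    field_simp
  have hw' : evalI L yArg
      ((1 - CR5 2 3 4 1 6 5 0) / (1 - CR5 3 4 0 9 6 2 5 * CR5 2 3 4 1 6 5 0)) = 0 := by
    rw [hw]
    apply evalI_eq_zero hL (i := 1) (j := 2) (by simp) (by simp) (by simp) yArg_swap_one_two
    simp [permAut_rhoBr, permAut_d5, Equiv.swap_apply_def, rhoBr_sort_one, d5_sort_one,
      d5_sort_two]
  rw [map_IW, hw0, hw', rr5_two_one, rr5_two_three]
  linear_combination (norm := module) hmix

lemma map_IW_top (hL : IsSkew L) :
    L (IW (CR5 3 4 0 9 6 2 5) (CR5 3 4 0 9 6 5 7) yArg) =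
      (3 : ℚ) • evalI L yArg (CR5 3 4 0 9 6 2 5) + evalI L yArg (CR5 3 4 0 2 5 6 7) := by
  have hne : ∀ i j k l m : ℕ, [i % 10, j % 10, k % 10, l % 10, m % 10].Nodup →
    d5 i j k l m ≠ 0 := d5_ne_zero
  have n1 := hne 0 2 3 4 5 (by simp)
  have n2 := hne 0 2 3 4 6 (by simp)
  have n3 := hne 0 2 3 4 7 (by simp)
  have n4 := hne 0 2 3 4 9 (by simp)
  have n5 := hne 0 3 4 5 6 (by simp)
  have n6 := hne 0 3 4 5 7 (by simp)
  have n7 := hne 0 3 4 5 9 (by simp)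
  have n8 := hne 0 3 4 6 7 (by simp)
  have n9 := hne 0 3 4 6 9 (by simp)
  have n10 := hne 0 3 4 7 9 (by simp)
  have huw : CR5 3 4 0 9 6 2 5 * CR5 3 4 0 9 6 5 7 = CR5 3 4 0 9 6 2 7 := by
    simp only [CR5, d5_sort_one, d5_sort_two, d5_sort_three, d5_sort_four, Nat.reduceLT]
    field_simp
  have hu : CR5 3 4 0 9 2 6 5 / CR5 3 4 0 9 2 6 7 = CR5 3 4 0 2 9 5 7 := by
    simp only [CR5, d5_sort_one, d5_sort_two, d5_sort_three, d5_sort_four, Nat.reduceLT]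
    field_simp
  have hw : CR5 3 4 0 9 5 6 7 / CR5 3 4 0 9 2 6 7 = CR5 3 4 0 2 5 6 7 := by
    simp only [CR5, d5_sort_one, d5_sort_two, d5_sort_three, d5_sort_four, Nat.reduceLT]
    field_simp
  have hw0 : evalI L yArg (CR5 3 4 0 9 6 5 7) = 0 := by
    apply evalI_eq_zero hL (i := 1) (j := 2) (by simp) (by simp) (by simp) yArg_swap_one_two
    simp [permAut_CR5, Equiv.swap_apply_def]
  have s57 := evalI_swap hL (i := 5) (j := 7) (x := CR5 3 4 0 9 6 2 5) (by simp) (by simp)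
    (by simp) yArg_swap_five_seven
  have s56 := evalI_swap hL (i := 5) (j := 6) (x := CR5 3 4 0 9 6 2 7) (by simp) (by simp)
    (by simp) yArg_swap_five_six
  simp only [permAut_CR5, Equiv.swap_apply_def, Nat.reduceLT, Nat.reduceEqDiff, if_true, if_false] at s57 s56
  rw [map_IW, hw0, huw, one_sub_CR5 (by simp), one_sub_CR5 (by simp), one_sub_CR5 (by simp), hu, hw]
  have c1 := evalI_CR5_swap_two_three (L := L) (y := yArg) (a := 3) (b := 4) (c := 0) (d := 9)
    (e := 6) (f := 2) (g := 7) (by simp)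
  have c2 := evalI_CR5_swap_two_three (L := L) (y := yArg) (a := 3) (b := 4) (c := 0) (d := 9)
    (e := 5) (f := 2) (g := 7) (by simp)
  have c3 := evalI_CR5_swap_three_four (L := L) (y := yArg) (a := 3) (b := 4) (c := 0) (d := 9)
    (e := 2) (f := 5) (g := 7) (by simp)
  rw [← CR5_swap_one_two] at c3
  rw [c3, c2, s56, c1, s57]
  module

lemma map_IW_mixed_two (hL : IsSkew L) :
    L (IW (CR5 4 5 0 9 7 3 6) (CR5 3 4 5 2 7 6 0) yArg) =
      evalI L yArg (CR5 3 4 5 2 7 6 0) + (2 : ℚ) •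
        evalI L yArg ((rhoBr 2 3 4 5 - rhoBr 3 4 5 6) / (rhoBr 2 3 4 5 - rhoBr 4 5 6 7)) := by
  have h36 : rhoBr 3 4 5 6 - rhoBr 4 5 6 7 =
      d5 0 4 5 6 9 * d5 3 4 5 6 7 / (d5 0 3 4 5 6 * d5 0 4 5 6 7) := by
    have h := rhoBr_sub (a := 4) (b := 5) (c := 6) (x := 3) (y := 7)
      (d5_ne_zero _ _ _ _ _ (by simp)) (d5_ne_zero _ _ _ _ _ (by simp))
    simp only [rhoBr_sort_one, rhoBr_sort_two, rhoBr_sort_three, d5_sort_one, d5_sort_two,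
      d5_sort_three, d5_sort_four, Nat.reduceLT] at h
    rw [h]
    ring
  have h26 : rhoBr 3 4 5 6 - rhoBr 2 3 4 5 =
      -(d5 0 3 4 5 9 * d5 2 3 4 5 6) / (d5 0 3 4 5 6 * d5 0 2 3 4 5) := by
    have h := rhoBr_sub (a := 3) (b := 4) (c := 5) (x := 6) (y := 2)
      (d5_ne_zero _ _ _ _ _ (by simp)) (d5_ne_zero _ _ _ _ _ (by simp))
    simp only [rhoBr_sort_one, rhoBr_sort_two, rhoBr_sort_three, d5_sort_one, d5_sort_two,
      d5_sort_three, d5_sort_four, Nat.reduceLT] at h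
    rw [h]
    ring
  have h37 : rhoBr 3 4 5 7 - rhoBr 4 5 6 7 =
      d5 0 4 5 7 9 * d5 3 4 5 6 7 / (d5 0 3 4 5 7 * d5 0 4 5 6 7) := by
    have h := rhoBr_sub (a := 4) (b := 5) (c := 7) (x := 3) (y := 6)
      (d5_ne_zero _ _ _ _ _ (by simp)) (d5_ne_zero _ _ _ _ _ (by simp))
    simp only [rhoBr_sort_one, rhoBr_sort_two, rhoBr_sort_three, d5_sort_one, d5_sort_two,
      d5_sort_three, d5_sort_four, Nat.reduceLT] at h
    rw [h]
    ring
  have n1 : d5 0 3 4 5 6 ≠ 0 := d5_ne_zero _ _ _ _ _ (by simp)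
  have n2 : d5 0 4 5 6 7 ≠ 0 := d5_ne_zero _ _ _ _ _ (by simp)
  have n3 : d5 0 2 3 4 5 ≠ 0 := d5_ne_zero _ _ _ _ _ (by simp)
  have n4 : d5 0 3 4 5 7 ≠ 0 := d5_ne_zero _ _ _ _ _ (by simp)
  have n5 : d5 0 4 5 6 9 ≠ 0 := d5_ne_zero _ _ _ _ _ (by simp)
  have n6 : d5 3 4 5 6 7 ≠ 0 := d5_ne_zero _ _ _ _ _ (by simp)
  have h24 := rho24_ne
  have h34 := rho34_ne
  have huw : CR5 4 5 0 9 7 3 6 * CR5 3 4 5 2 7 6 0 =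
      (rhoBr 3 4 5 6 - rhoBr 2 3 4 5) / (rhoBr 3 4 5 6 - rhoBr 4 5 6 7) := by
    rw [h36, h26]
    simp only [CR5, d5_sort_one, d5_sort_two, d5_sort_three, d5_sort_four, Nat.reduceLT]
    field_simp
  have hu : (1 - CR5 4 5 0 9 7 3 6) * (rhoBr 3 4 5 6 - rhoBr 4 5 6 7) =
      rhoBr 3 4 5 7 - rhoBr 4 5 6 7 := by
    rw [one_sub_CR5 (by simp), h36, h37]
    simp only [CR5, d5_sort_one, d5_sort_two, d5_sort_three, d5_sort_four, Nat.reduceLT]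
    field_simp
  have hmix := evalI_mixed (L := L) (y := yArg)
    (permAut 10 5 (Equiv.swap (L10 6) (L10 7)))
    (evalI_swap hL (by simp) (by simp) (by simp) yArg_swap_six_seven)
    (by simp [permAut_rhoBr, Equiv.swap_apply_def])
    (r := rhoBr 3 4 5 7) (by simp [permAut_rhoBr, Equiv.swap_apply_def])
    (by simp [permAut_rhoBr, Equiv.swap_apply_def, rhoBr_sort_three])
    rho23_ne h24 h34 huw hu
  have hu0 : evalI L yArg (CR5 4 5 0 9 7 3 6) = 0 := by
    apply evalI_eq_zero hL (i := 1) (j := 2) (by simp) (by simp) (by simp) yArg_swap_one_two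
    simp [permAut_CR5, Equiv.swap_apply_def]
  have hw : (1 - CR5 3 4 5 2 7 6 0) / (1 - CR5 4 5 0 9 7 3 6 * CR5 3 4 5 2 7 6 0) =
      d5 2 3 4 5 7 * d5 0 4 5 6 9 / (d5 0 2 3 4 5 * d5 0 4 5 6 7) /
        (rhoBr 2 3 4 5 - rhoBr 4 5 6 7) := by
    have : 1 - (rhoBr 3 4 5 6 - rhoBr 2 3 4 5) / (rhoBr 3 4 5 6 - rhoBr 4 5 6 7) =
        (rhoBr 2 3 4 5 - rhoBr 4 5 6 7) / (rhoBr 3 4 5 6 - rhoBr 4 5 6 7) := by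
      field_simp
      ring
    rw [huw, this, div_div_eq_mul_div, one_sub_CR5 (by simp), h36]
    congr 1
    simp only [CR5, d5_sort_one, d5_sort_two, d5_sort_three, d5_sort_four, Nat.reduceLT]
    field_simp
  have hw' : evalI L yArg
      ((1 - CR5 3 4 5 2 7 6 0) / (1 - CR5 4 5 0 9 7 3 6 * CR5 3 4 5 2 7 6 0)) = 0 := by
    rw [hw]
    apply evalI_eq_zero hL (i := 2) (j := 3) (by simp) (by simp) (by simp) yArg_swap_two_three
    simp [permAut_rhoBr, permAut_d5, Equiv.swap_apply_def, rhoBr_sort_one, d5_sort_one,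
      d5_sort_two]
  have hratio : evalI L yArg
      ((rhoBr 3 4 5 6 - rhoBr 2 3 4 5) / (rhoBr 3 4 5 6 - rhoBr 4 5 6 7)) =
      -evalI L yArg ((rhoBr 2 3 4 5 - rhoBr 3 4 5 6) / (rhoBr 2 3 4 5 - rhoBr 4 5 6 7)) :=
    evalI_ratio_swap L rho23_ne h24 h34
  rw [hratio] at hmix
  rw [map_IW, hu0, hw']
  linear_combination (norm := module) hmix

lemma map_IW_bottom (hL : IsSkew L) :
    L (IW (CR5 3 4 5 2 7 0 6) (CR5 3 4 7 2 5 6 0) yArg) =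
      -(3 : ℚ) • evalI L yArg (CR5 3 4 5 2 7 6 0) - evalI L yArg (CR5 3 4 0 2 5 6 7) := by
  have hne : ∀ i j k l m : ℕ, [i % 10, j % 10, k % 10, l % 10, m % 10].Nodup →
    d5 i j k l m ≠ 0 := d5_ne_zero
  have n1 := hne 0 2 3 4 5 (by simp)
  have n2 := hne 0 2 3 4 6 (by simp)
  have n3 := hne 0 2 3 4 7 (by simp)
  have n4 := hne 2 3 4 5 6 (by simp)
  have n5 := hne 0 3 4 5 6 (by simp)
  have n6 := hne 0 3 4 5 7 (by simp)
  have n7 := hne 2 3 4 5 7 (by simp)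
  have n8 := hne 0 3 4 6 7 (by simp)
  have n9 := hne 2 3 4 6 7 (by simp)
  have n10 := hne 3 4 5 6 7 (by simp)
  have huw : CR5 3 4 5 2 7 0 6 * CR5 3 4 7 2 5 6 0 = CR5 3 4 2 5 7 0 6 := by
    simp only [CR5, d5_sort_one, d5_sort_two, d5_sort_three, d5_sort_four, Nat.reduceLT]
    field_simp
  have hu : CR5 3 4 5 2 0 7 6 / CR5 3 4 2 5 0 7 6 = CR5 3 4 0 5 2 6 7 := by
    simp only [CR5, d5_sort_one, d5_sort_two, d5_sort_three, Nat.reduceLT]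
    field_simp
  have hw : CR5 3 4 7 2 6 5 0 / CR5 3 4 2 5 0 7 6 = CR5 3 4 6 2 7 5 0 := by
    simp only [CR5, d5_sort_one, d5_sort_two, d5_sort_three, d5_sort_four, Nat.reduceLT]
    field_simp
  have huw0 : evalI L yArg (CR5 3 4 2 5 0 7 6) = 0 := by
    apply evalI_eq_zero hL (i := 2) (j := 3) (by simp) (by simp) (by simp) yArg_swap_two_three
    rw [permAut_CR5 (by simp) (by simp) (by simp) (by simp) (by simp) (by simp) (by simp) (by simp)
      (by simp)]
    simp [Equiv.swap_apply_def, CR5, d5_sort_one, d5_sort_two, d5_sort_three]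
  have s57 := evalI_swap hL (i := 5) (j := 7) (x := CR5 3 4 5 2 7 6 0) (by simp) (by simp)
    (by simp) yArg_swap_five_seven
  have s56 := evalI_swap hL (i := 5) (j := 6) (x := CR5 3 4 7 2 5 6 0) (by simp) (by simp)
    (by simp) yArg_swap_five_six
  have s67 := evalI_swap hL (i := 6) (j := 7) (x := CR5 3 4 7 2 6 5 0) (by simp) (by simp)
    (by simp) yArg_swap_six_seven
  simp only [permAut_CR5, Equiv.swap_apply_def, Nat.reduceLT, Nat.reduceEqDiff, if_true, if_false,
    OfNat.zero_ne_ofNat] at s57 s56 s67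
  have c1 := evalI_CR5_swap_three_four (L := L) (y := yArg) (a := 3) (b := 4) (c := 5) (d := 2)
    (e := 7) (f := 6) (g := 0) (by simp)
  have c2 := evalI_CR5_swap_three_four (L := L) (y := yArg) (a := 3) (b := 4) (c := 0) (d := 2)
    (e := 5) (f := 6) (g := 7) (by simp)
  rw [← CR5_swap_one_two] at c2
  rw [map_IW, huw, one_sub_CR5 (by simp), one_sub_CR5 (by simp), one_sub_CR5 (by simp), hu, hw,
    huw0, c1, c2, s67, s56, s57]
  module

lemma map_eq_of_isSkew (hL : IsSkew L) :
    L ((2 : ℚ) • tI41p (rr5 1 2 * rr5 3 4 / (rr5 1 4 * rr5 3 2)) yArg) =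
      L ((-2 : ℚ) • IW (rr5 2 1 / rr5 2 3) (rr5 3 4 / rr5 1 4) yArg
        - IW (CR5 3 4 0 9 6 2 5) (CR5 2 3 4 1 6 5 0) yArg
        + IW (CR5 4 5 0 9 7 3 6) (CR5 3 4 5 2 7 6 0) yArg
        + (3 : ℚ)⁻¹ • IW (CR5 3 4 0 9 6 2 5) (CR5 3 4 0 9 6 5 7) yArg
        + (3 : ℚ)⁻¹ • IW (CR5 3 4 5 2 7 0 6) (CR5 3 4 7 2 5 6 0) yArg) := by
  simp only [map_add, map_sub, map_smul, map_IW_rho hL, map_IW_mixed_one hL, map_IW_mixed_two hL,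
    map_IW_top hL, map_IW_bottom hL]
  rw [← evalI]
  module

end Configuration

lemma exists_linearMap_eq_Alt_Pit (N m n : ℕ) :
    ∃ L : TP (FF N m) n →ₗ[ℚ] TP (FF N m) n, (∀ t, L t = Alt (Pit n t)) ∧
      ∀ (τ : Equiv.Perm (Fin N)) (t : TP (FF N m) n), L (tpMap (permAut N m τ) t) =
        (((Equiv.Perm.sign τ : ℤˣ) : ℤ) : ℚ) • L t := by
  have h : ∀ t : TP (FF N m) n, ((∑ σ : Equiv.Perm (Fin N),
      (((Equiv.Perm.sign σ : ℤˣ) : ℤ) : ℚ) • tpMap (permAut N m σ)) ∘ₗ Pit n) t =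
        Alt (Pit n t) := by
    intro t
    simp [Alt]
  refine ⟨_, h, fun τ t => ?_⟩
  rw [h, h, ← tpMap_Pit, Alt_tpMap]

end

end GrassPoly

/-- Lemma `gr5sum2`. -/
theorem lemma_gr5sum2 :
    Alt (Pit 5 ((2 : ℚ) •
        tI41p (rr5 1 2 * rr5 3 4 / (rr5 1 4 * rr5 3 2)) (rr5 4 5 / rr5 4 1))) =
      Alt (Pit 5 (
        (-2 : ℚ) • IW (rr5 2 1 / rr5 2 3) (rr5 3 4 / rr5 1 4) (rr5 4 5 / rr5 4 1)
        - IW (CR5 3 4 0 9 6 2 5) (CR5 2 3 4 1 6 5 0) (rr5 4 5 / rr5 4 1)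
        + IW (CR5 4 5 0 9 7 3 6) (CR5 3 4 5 2 7 6 0) (rr5 4 5 / rr5 4 1)
        + (3 : ℚ)⁻¹ • IW (CR5 3 4 0 9 6 2 5) (CR5 3 4 0 9 6 5 7) (rr5 4 5 / rr5 4 1)
        + (3 : ℚ)⁻¹ • IW (CR5 3 4 5 2 7 0 6) (CR5 3 4 7 2 5 6 0) (rr5 4 5 / rr5 4 1))) := by
  obtain ⟨L, hL, hskew⟩ := exists_linearMap_eq_Alt_Pit 10 5 5
  exact (hL _).symm.trans ((map_eq_of_isSkew hskew).trans (hL _))
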